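/- The poset P5 has no spine: there is no chain C in P5 together with a partition of P5 into antichains such that every antichain of the partition meets C. -/

import Mathlib

/-- The order relation of the poset `P5` on `ℕ × ℕ × ℕ`.  Writing a point as
`(x, y, n)`, we have `(x, y, n) ≤ (u, v, m)` iff `n ≥ m + 2`, or `n = m` with
`x ≤ u` and `y ≤ v`, or `n = m + 1` with `min x y + 1 ≤ min u v`, or `n = m + 1`
with `x + y ≤ 2 * (u + v)`. -/
def P5le : ℕ × ℕ × ℕ → ℕ × ℕ × ℕ → Prop := fun p q =>
  q.2.2 + 2 ≤ p.2.2 ∨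
  (p.2.2 = q.2.2 ∧ p.1 ≤ q.1 ∧ p.2.1 ≤ q.2.1) ∨
  (p.2.2 = q.2.2 + 1 ∧ min p.1 p.2.1 + 1 ≤ min q.1 q.2.1) ∨
  (p.2.2 = q.2.2 + 1 ∧ p.1 + p.2.1 ≤ 2 * (q.1 + q.2.1))

/-- A chain `C` is a spine of a poset (w.r.t. the order relation `r`) if there is a
partition of the whole poset into antichains such that `C` meets every antichain
of the partition. -/
def IsSpine {α : Type*} (r : α → α → Prop) (C : Set α) : Prop :=
  ∃ 𝒜 : Set (Set α),
    (∀ A ∈ 𝒜, IsAntichain r A) ∧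
    (∀ x : α, ∃! A, A ∈ 𝒜 ∧ x ∈ A) ∧
    (∀ A ∈ 𝒜, (A ∩ C).Nonempty)

theorem P5le_of_coord_le {x y u v n : ℕ} (hx : x ≤ u) (hy : y ≤ v) :
    P5le (x, y, n) (u, v, n) :=
  Or.inr (Or.inl ⟨rfl, hx, hy⟩)

theorem P5le_of_min_lt {x y u v n : ℕ} (h : min x y < min u v) :
    P5le (x, y, n + 1) (u, v, n) :=
  Or.inr (Or.inr (Or.inl ⟨rfl, h⟩))

/-- A retraction of `ℕ × ℕ × ℕ` onto the set `C` whose fibres are antichains for `P5le`. -/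
structure IsAntichainRetraction (C : Set (ℕ × ℕ × ℕ)) (f : ℕ × ℕ × ℕ → ℕ × ℕ × ℕ) : Prop where
  mem : ∀ p, f p ∈ C
  apply_of_mem : ∀ c ∈ C, f c = c
  eq_of_le : ∀ p q, f p = f q → P5le p q → p = q

theorem IsSpine.exists_isAntichainRetraction {C : Set (ℕ × ℕ × ℕ)} (hC : IsChain P5le C)
    (h : IsSpine P5le C) : ∃ f, IsAntichainRetraction C f := by
  obtain ⟨𝒜, hanti, hpart, hmeet⟩ := h
  choose A hA hA' using hpart
  choose g hg using hmeet
  have key : ∀ p, g (A p) (hA p).1 ∈ A p ∩ C := fun p => hg _ _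
  refine ⟨fun p => g (A p) (hA p).1, fun p => (key p).2, fun c hc => ?_, fun p q hpq hle => ?_⟩
  · by_contra hne
    rcases hC (key c).2 hc hne with hle | hle
    · exact hanti _ (hA c).1 (key c).1 (hA c).2 hne hle
    · exact hanti _ (hA c).1 (hA c).2 (key c).1 (Ne.symm hne) hle
  · have hAq : A p = A q :=
      hA' q (A p) ⟨(hA p).1, by
        have h₁ := hA' (g (A p) (hA p).1) (A p) ⟨(hA p).1, (key p).1⟩
        have h₂ := hA' (g (A p) (hA p).1) (A q) ⟨(hA q).1, by
          have := (key q).1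
          rwa [← hpq] at this⟩
        rw [h₁, ← h₂]
        exact (hA q).2⟩
    by_contra hne
    refine hanti _ (hA p).1 (hA p).2 ?_ hne hle
    rw [hAq]
    exact (hA q).2

theorem IsChain.coord_le_of_sum_le {C : Set (ℕ × ℕ × ℕ)} (hC : IsChain P5le C)
    {x y u v n : ℕ} (h₁ : (x, y, n) ∈ C) (h₂ : (u, v, n) ∈ C) (hs : x + y ≤ u + v) :
    x ≤ u ∧ y ≤ v := by
  by_cases he : (x, y, n) = (u, v, n)
  · simp only [Prod.mk.injEq] at he
    omega
  · rcases hC h₁ h₂ he with h | h <;> simp only [P5le] at h <;> omega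

theorem IsChain.le_of_succ_layer {C : Set (ℕ × ℕ × ℕ)} (hC : IsChain P5le C)
    {x y u v n : ℕ} (h₁ : (x, y, n + 1) ∈ C) (h₂ : (u, v, n) ∈ C) :
    min x y + 1 ≤ min u v ∨ x + y ≤ 2 * (u + v) := by
  rcases hC h₁ h₂ (by simp) with h | h <;> simp only [P5le] at h <;> omega

namespace IsAntichainRetraction

variable {C : Set (ℕ × ℕ × ℕ)} {f : ℕ × ℕ × ℕ → ℕ × ℕ × ℕ}

theorem eq_or_incomparable (hf : IsAntichainRetraction C f) (p : ℕ × ℕ × ℕ) :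
    p = f p ∨ (¬ P5le p (f p) ∧ ¬ P5le (f p) p) := by
  have hff : f (f p) = f p := hf.apply_of_mem _ (hf.mem p)
  by_cases h : p = f p
  · exact Or.inl h
  · exact Or.inr ⟨fun hle => h (hf.eq_of_le _ _ hff.symm hle),
      fun hle => h (hf.eq_of_le _ _ hff hle).symm⟩

/-- Every point is either fixed, or moved to an incomparable point of the same or an
adjacent layer. -/
theorem cases (hf : IsAntichainRetraction C f) (x y n : ℕ) :
    ∃ u v k, f (x, y, n) = (u, v, k) ∧ (u, v, k) ∈ C ∧
      ((k = n ∧ (x = u ∧ y = v ∨ (x < u ∧ v < y) ∨ (u < x ∧ y < v))) ∨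
       (n = k + 1 ∧ min u v ≤ min x y ∧ 2 * (u + v) < x + y) ∨
       (k = n + 1 ∧ min x y ≤ min u v ∧ 2 * (x + y) < u + v)) := by
  have h := hf.eq_or_incomparable (x, y, n)
  have hm := hf.mem (x, y, n)
  generalize f (x, y, n) = q at *
  obtain ⟨u, v, k⟩ := q
  refine ⟨u, v, k, rfl, hm, ?_⟩
  simp only [P5le, Prod.mk.injEq] at h
  omega

/-- Every row contains a point that is not moved to the layer above. -/
theorem exists_row_not_above (hC : IsChain P5le C) (hf : IsAntichainRetraction C f) (m n : ℕ) :
    ∃ i, (f (m + i, m, n)).2.2 + 1 ≠ n := by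
  by_contra! hall
  have hmaps : ∀ i ∈ Finset.range (2 * m + 2),
      (f (m + i, m, n)).1 + (f (m + i, m, n)).2.1 ∈ Finset.range (2 * m + 1) := by
    intro i hi
    obtain ⟨u, v, k, he, -, h⟩ := hf.cases (m + i) m n
    have := hall i
    simp only [he, Finset.mem_range] at *
    omega
  obtain ⟨i, -, j, -, hij, he⟩ :=
    Finset.exists_ne_map_eq_of_card_lt_of_maps_to (by simp) hmaps
  obtain ⟨u, v, k, hi, hiC, -⟩ := hf.cases (m + i) m n
  obtain ⟨u', v', k', hj, hjC, -⟩ := hf.cases (m + j) m n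
  have hi' := hall i
  have hj' := hall j
  simp only [hi, hj] at he hi' hj'
  obtain rfl : k = k' := by omega
  have h₁ := hC.coord_le_of_sum_le hiC hjC he.le
  have h₂ := hC.coord_le_of_sum_le hjC hiC he.ge
  have hff : f (m + i, m, n) = f (m + j, m, n) := by
    rw [hi, hj, show u = u' by omega, show v = v' by omega]
  rcases le_total i j with hle | hle
  · have := hf.eq_of_le _ _ hff (P5le_of_coord_le (by omega) (by omega))
    simp only [Prod.mk.injEq] at this
    omega
  · have := hf.eq_of_le _ _ hff.symm (P5le_of_coord_le (by omega) (by omega))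
    simp only [Prod.mk.injEq] at this
    omega

/-- A layer that meets the chain meets it in points of arbitrarily large coordinate sum. -/
theorem exists_large_sum (hC : IsChain P5le C) (hf : IsAntichainRetraction C f)
    {a b n : ℕ} (hab : (a, b, n) ∈ C) (B : ℕ) : ∃ x y, (x, y, n) ∈ C ∧ B < x + y := by
  by_contra! hB
  obtain ⟨i, hi⟩ := hf.exists_row_not_above hC (B + a + b + 1) n
  obtain ⟨u, v, k, he, huv, h⟩ := hf.cases (B + a + b + 1 + i) (B + a + b + 1) n
  simp only [he] at hi
  rcases h with ⟨rfl, h⟩ | h | ⟨rfl, h⟩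
  · have := hB _ _ huv
    omega
  · omega
  · have := hC.le_of_succ_layer huv hab
    omega

/-- Below a layer missed by the chain, the chain is unbounded in both coordinates. -/
theorem exists_mem_succ_layer (hC : IsChain P5le C) (hf : IsAntichainRetraction C f)
    {n : ℕ} (hn : ∀ x y, (x, y, n) ∉ C) (m : ℕ) :
    ∃ x y u v, f (x, y, n) = (u, v, n + 1) ∧ (u, v, n + 1) ∈ C ∧
      m ≤ min x y ∧ m ≤ min u v := by
  obtain ⟨i, hi⟩ := hf.exists_row_not_above hC m n
  obtain ⟨u, v, k, he, huv, h⟩ := hf.cases (m + i) m n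
  simp only [he] at hi
  rcases h with ⟨rfl, h⟩ | h | ⟨rfl, h⟩
  · exact absurd huv (hn _ _)
  · omega
  · exact ⟨m + i, m, u, v, he, huv, by omega, by omega⟩

/-- Suppose the chain misses layer `n`, and let `(a, b)` be its least point in layer `n + 1`.
A point of the chain in layer `n + 1` has, on the monotone path that runs along row `b` from
`(a, b)` to column `X` and then up to `(X, Y)`, a point of its fibre, provided that `(X, Y)` is
a point of the chain lying above it. -/
theorem exists_mem_path (hC : IsChain P5le C) (hf : IsAntichainRetraction C f)
    {n a b x y X Y : ℕ} (hn : ∀ x y, (x, y, n) ∉ C) (hab : (a, b, n + 1) ∈ C)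
    (hmin : ∀ u v, (u, v, n + 1) ∈ C → a + b ≤ u + v)
    (hxy : (x, y, n + 1) ∈ C) (hXY : (X, Y, n + 1) ∈ C)
    (haX : a ≤ X) (hbY : b ≤ Y) (hle : x + y ≤ X + Y) :
    ∃ u v, f (u, v, n + 1) = (x, y, n + 1) ∧ (v = b ∨ u = X) := by
  let K := X - a + (Y - b) + 1
  let path : ℕ → ℕ × ℕ × ℕ := fun k => (a + min k (X - a), b + (k - (X - a)), n + 1)
  have hpath : ∀ k < K, ∃ u v, f (path k) = (u, v, n + 1) ∧ (u, v, n + 1) ∈ C ∧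
      a + b ≤ u + v ∧ u + v ≤ X + Y := by
    intro k hk
    obtain ⟨u, v, l, he, huv, h⟩ := hf.cases (a + min k (X - a)) (b + (k - (X - a))) (n + 1)
    rcases h with ⟨rfl, h⟩ | ⟨hl, h⟩ | ⟨rfl, h⟩
    · refine ⟨u, v, he, huv, hmin _ _ huv, ?_⟩
      by_contra! hlt
      have := hC.coord_le_of_sum_le hXY huv hlt.le
      omega
    · obtain rfl : n = l := by omega
      exact absurd huv (hn _ _)
    · have := hC.le_of_succ_layer huv hab
      omega
  let g : ℕ → ℕ := fun k => (f (path k)).1 + (f (path k)).2.1 - (a + b)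
  have hmaps : Set.MapsTo g (Finset.range K) (Finset.range K) := by
    intro k hk
    obtain ⟨u, v, he, -, h₁, h₂⟩ := hpath k (by simpa using hk)
    simp only [g, he, Finset.coe_range, Set.mem_Iio, K]
    omega
  have hinj : Set.InjOn g (Finset.range K) := by
    intro i hi j hj hij
    obtain ⟨u, v, he, hu, h₁, h₂⟩ := hpath i (by simpa using hi)
    obtain ⟨u', v', he', hu', h₁', h₂'⟩ := hpath j (by simpa using hj)
    simp only [g, he, he'] at hij
    have h₃ := hC.coord_le_of_sum_le hu hu' (by omega)
    have h₄ := hC.coord_le_of_sum_le hu' hu (by omega)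
    have hff : f (path i) = f (path j) := by
      rw [he, he', show u = u' by omega, show v = v' by omega]
    rcases le_total i j with hle | hle
    · have := hf.eq_of_le _ _ hff (P5le_of_coord_le (by omega) (by omega))
      simp only [path, Prod.mk.injEq] at this
      omega
    · have := hf.eq_of_le _ _ hff.symm (P5le_of_coord_le (by omega) (by omega))
      simp only [path, Prod.mk.injEq] at this
      omega
  have hsurj := Finset.surjOn_of_injOn_of_card_le g hmaps hinj le_rfl
  have hxy' := hmin _ _ hxy
  obtain ⟨k, hk, hgk⟩ := hsurj (show x + y - (a + b) ∈ (Finset.range K : Set ℕ) by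
    simp only [Finset.coe_range, Set.mem_Iio, K]; omega)
  obtain ⟨u, v, he, hu, h₁, h₂⟩ := hpath k (by simpa using hk)
  simp only [g, he] at hgk
  have h₃ := hC.coord_le_of_sum_le hu hxy (by omega)
  have h₄ := hC.coord_le_of_sum_le hxy hu (by omega)
  refine ⟨a + min k (X - a), b + (k - (X - a)), ?_, by omega⟩
  change f (path k) = _
  rw [he, show u = x by omega, show v = y by omega]

/-- Below a layer missed by the chain, every fibre over the chain meets a fixed row. -/
theorem exists_mem_row (hC : IsChain P5le C) (hf : IsAntichainRetraction C f)
    {n a b x y : ℕ} (hn : ∀ x y, (x, y, n) ∉ C) (hab : (a, b, n + 1) ∈ C)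
    (hmin : ∀ u v, (u, v, n + 1) ∈ C → a + b ≤ u + v) (hxy : (x, y, n + 1) ∈ C) :
    ∃ u, f (u, b, n + 1) = (x, y, n + 1) := by
  classical
  have hex : ∃ v u, f (u, v, n + 1) = (x, y, n + 1) := ⟨y, x, hf.apply_of_mem _ hxy⟩
  obtain ⟨u, hu⟩ := Nat.find_spec hex
  obtain ⟨-, -, X, Y, -, hXY, -, hlarge⟩ :=
    hf.exists_mem_succ_layer hC hn (a + b + x + y + u + 1)
  obtain ⟨u', v', he, h⟩ := hf.exists_mem_path hC hn hab hmin hxy hXY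
    (by omega) (by omega) (by omega)
  rcases h with rfl | rfl
  · exact ⟨u', he⟩
  · have hle := Nat.find_min' hex ⟨u', he⟩
    have := hf.eq_of_le _ _ (hu.trans he.symm) (P5le_of_coord_le (by omega) (by omega))
    simp only [Prod.mk.injEq] at this
    omega

theorem exists_mem_layer (hC : IsChain P5le C) (hf : IsAntichainRetraction C f) (n : ℕ) :
    ∃ x y, (x, y, n) ∈ C := by
  classical
  by_contra! hn
  have hex : ∃ s a b, (a, b, n + 1) ∈ C ∧ a + b = s := by
    obtain ⟨-, -, u, v, -, huv, -⟩ := hf.exists_mem_succ_layer hC hn 0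
    exact ⟨_, u, v, huv, rfl⟩
  obtain ⟨a, b, hab, hs⟩ := Nat.find_spec hex
  have hmin : ∀ u v, (u, v, n + 1) ∈ C → a + b ≤ u + v := fun u v huv =>
    hs.trans_le (Nat.find_min' hex ⟨u, v, huv, rfl⟩)
  obtain ⟨x, y, u, v, he, huv, hlarge, -⟩ := hf.exists_mem_succ_layer hC hn (b + 1)
  obtain ⟨w, hw⟩ := hf.exists_mem_row hC hn hab hmin huv
  have := hf.eq_of_le _ _ (hw.trans he.symm) (P5le_of_min_lt (by omega))
  simp only [Prod.mk.injEq] at this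
  omega

theorem le_min_of_mem (hC : IsChain P5le C) (hf : IsAntichainRetraction C f) (m : ℕ) :
    ∀ n x y, (x, y, n) ∈ C → m ≤ min x y := by
  induction m with
  | zero => simp
  | succ m ih =>
    intro n x y hxy
    obtain ⟨a, b, hab⟩ := hf.exists_mem_layer hC (n + 1)
    obtain ⟨u, v, huv, hlarge⟩ := hf.exists_large_sum hC hab (2 * (x + y))
    have := ih _ _ _ huv
    have := hC.le_of_succ_layer huv hxy
    omega

end IsAntichainRetraction

/-- The poset `P5` has no spine. -/
theorem P5_no_spine :
    ¬ ∃ C : Set (ℕ × ℕ × ℕ), IsChain P5le C ∧ IsSpine P5le C := by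
  rintro ⟨C, hC, hS⟩
  obtain ⟨f, hf⟩ := hS.exists_isAntichainRetraction hC
  obtain ⟨x, y, hxy⟩ := hf.exists_mem_layer hC 0
  have := hf.le_min_of_mem hC (x + 1) 0 x y hxy
  omega
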